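/- (Theorem 4.4-(2), Existence and uniqueness of the optimal value function.) In an MG-SPA, there exists a unique function v* : S → ℝ satisfying the Bellman optimality equation L v* = v*, i.e. v*(s) = ⨆_{x : B → stdSimplex ℝ A} ⨅_{y ∈ stdSimplex ℝ B} ∑_{b} y b · ∑_{a} (x b) a · (r s a b + γ · ∑_{s'} p s a b s' · v*(s')) for every s ∈ S. -/

import Mathlib

open scoped BigOperators

section MGSPA

variable {S A B : Type*}

/-- The induced one-step expected reward of the joint policy `(π, ρ)`:
`r_{π,ρ}(s) = ∑ b, (ρ s) b * ∑ a, (π s b) a * r s a b`. -/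
noncomputable def rPol [Fintype A] [Fintype B]
    (r : S → A → B → ℝ)
    (π : S → B → stdSimplex ℝ A) (ρ : S → stdSimplex ℝ B) : S → ℝ :=
  fun s => ∑ b, (ρ s : B → ℝ) b * ∑ a, (π s b : A → ℝ) a * r s a b

/-- The induced state-transition matrix of the joint policy `(π, ρ)`:
`P_{π,ρ}(s, s') = ∑ b, (ρ s) b * ∑ a, (π s b) a * p s a b s'`. -/
noncomputable def PPol [Fintype A] [Fintype B]
    (p : S → A → B → S → ℝ)
    (π : S → B → stdSimplex ℝ A) (ρ : S → stdSimplex ℝ B) : Matrix S S ℝ :=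
  fun s s' => ∑ b, (ρ s : B → ℝ) b * ∑ a, (π s b : A → ℝ) a * p s a b s'

/-- The value function of the joint policy `(π, ρ)`:
`v_{π,ρ}(s) = ∑' t, γ^t * ((P_{π,ρ}^t) *ᵥ r_{π,ρ}) s`. -/
noncomputable def vFn [Fintype S] [DecidableEq S] [Fintype A] [Fintype B]
    (γ : ℝ) (r : S → A → B → ℝ) (p : S → A → B → S → ℝ)
    (π : S → B → stdSimplex ℝ A) (ρ : S → stdSimplex ℝ B) : S → ℝ :=
  fun s => ∑' t : ℕ, γ ^ t * (((PPol p π ρ) ^ t).mulVec (rPol r π ρ)) s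

/-- The minimax (Shapley) Bellman operator of the MG-SPA. -/
noncomputable def Lop [Fintype S] [Fintype A] [Fintype B]
    (γ : ℝ) (r : S → A → B → ℝ) (p : S → A → B → S → ℝ)
    (v : S → ℝ) : S → ℝ :=
  fun s => ⨆ x : B → stdSimplex ℝ A, ⨅ y : stdSimplex ℝ B,
    ∑ b, (y : B → ℝ) b * ∑ a, (x b : A → ℝ) a *
      (r s a b + γ * ∑ s', p s a b s' * v s')

end MGSPA

open scoped NNReal in
/-- A map on real functions over a finite type that satisfies a one-sided Lipschitz bound is
Lipschitz for the sup norm. -/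
theorem lipschitzWith_of_apply_le_add {S : Type*} [Fintype S] {K : ℝ≥0}
    {T : (S → ℝ) → S → ℝ} (h : ∀ v w s, T v s ≤ T w s + K * dist v w) : LipschitzWith K T := by
  refine LipschitzWith.of_dist_le_mul fun v w => (dist_pi_le_iff (by positivity)).2 fun s => ?_
  rw [Real.dist_eq, abs_le]
  have h₁ := h v w s
  have h₂ := h w v s
  rw [dist_comm] at h₂
  constructor <;> linarith

theorem sum_stdSimplex_mul_le {A : Type*} [Fintype A] (x : stdSimplex ℝ A) {f g : A → ℝ} {c : ℝ}
    (h : ∀ a, f a ≤ g a + c) : ∑ a, (x : A → ℝ) a * f a ≤ ∑ a, (x : A → ℝ) a * g a + c := by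
  calc ∑ a, (x : A → ℝ) a * f a ≤ ∑ a, (x : A → ℝ) a * (g a + c) :=
        Finset.sum_le_sum fun a _ => mul_le_mul_of_nonneg_left (h a) (x.2.1 a)
    _ = ∑ a, (x : A → ℝ) a * g a + c := by
        simp_rw [mul_add, Finset.sum_add_distrib, ← Finset.sum_mul]
        rw [stdSimplex.sum_eq_one, one_mul]

/-- The expected payoff of the matrix `q` under the mixed strategies `x` and `y`, where the
maximizer observes the choice of the minimizer. -/
noncomputable def expectedPayoff {A B : Type*} [Fintype A] [Fintype B] (q : A → B → ℝ)
    (x : B → stdSimplex ℝ A) (y : stdSimplex ℝ B) : ℝ :=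
  ∑ b, (y : B → ℝ) b * ∑ a, (x b : A → ℝ) a * q a b

section expectedPayoff

variable {A B : Type*} [Fintype A] [Fintype B]

theorem expectedPayoff_le_add {q q' : A → B → ℝ} {c : ℝ} (h : ∀ a b, q a b ≤ q' a b + c)
    (x : B → stdSimplex ℝ A) (y : stdSimplex ℝ B) :
    expectedPayoff q x y ≤ expectedPayoff q' x y + c :=
  sum_stdSimplex_mul_le y fun b => sum_stdSimplex_mul_le (x b) fun a => h a b

theorem abs_expectedPayoff_le (q : A → B → ℝ) (x : B → stdSimplex ℝ A) (y : stdSimplex ℝ B) :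
    |expectedPayoff q x y| ≤ ‖q‖ := by
  have hq a b : |q a b| ≤ ‖q‖ := (norm_le_pi_norm (q a) b).trans (norm_le_pi_norm q a)
  have h₁ := expectedPayoff_le_add (q := q) (q' := 0) (c := ‖q‖)
    (fun a b => by simpa using (abs_le.1 (hq a b)).2) x y
  have h₂ := expectedPayoff_le_add (q := 0) (q' := q) (c := ‖q‖)
    (fun a b => by simpa using neg_le_iff_add_nonneg.1 (abs_le.1 (hq a b)).1) x y
  have h₀ : expectedPayoff (0 : A → B → ℝ) x y = 0 := by simp [expectedPayoff]
  rw [h₀] at h₁ h₂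
  exact abs_le.2 ⟨by linarith, by linarith⟩

theorem bddBelow_range_expectedPayoff (q : A → B → ℝ) (x : B → stdSimplex ℝ A) :
    BddBelow (Set.range (expectedPayoff q x)) :=
  ⟨-‖q‖, Set.forall_mem_range.2 fun y => (abs_le.1 (abs_expectedPayoff_le q x y)).1⟩

theorem bddAbove_range_iInf_expectedPayoff [Nonempty B] (q : A → B → ℝ) :
    BddAbove (Set.range fun x => ⨅ y, expectedPayoff q x y) := by
  obtain ⟨y⟩ : Nonempty (stdSimplex ℝ B) := inferInstance
  exact ⟨‖q‖, Set.forall_mem_range.2 fun x =>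
    (ciInf_le (bddBelow_range_expectedPayoff q x) y).trans
      (abs_le.1 (abs_expectedPayoff_le q x y)).2⟩

theorem iSup_iInf_expectedPayoff_le_add [Nonempty A] [Nonempty B] {q q' : A → B → ℝ} {c : ℝ}
    (h : ∀ a b, q a b ≤ q' a b + c) :
    ⨆ x, ⨅ y, expectedPayoff q x y ≤ (⨆ x, ⨅ y, expectedPayoff q' x y) + c := by
  refine ciSup_le fun x => ?_
  have hx : (⨅ y, expectedPayoff q x y) - c ≤ ⨅ y, expectedPayoff q' x y :=
    le_ciInf fun y => sub_le_iff_le_add.2 <|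
      (ciInf_le (bddBelow_range_expectedPayoff q x) y).trans (expectedPayoff_le_add h x y)
  exact sub_le_iff_le_add.1 (hx.trans (le_ciSup (bddAbove_range_iInf_expectedPayoff q') x))

end expectedPayoff

theorem Lop_le_add {S A B : Type*} [Fintype S] [Fintype A] [Nonempty A] [Fintype B] [Nonempty B]
    {γ : ℝ} (hγ0 : 0 ≤ γ) (r : S → A → B → ℝ) {p : S → A → B → S → ℝ}
    (hp0 : ∀ s a b s', 0 ≤ p s a b s') (hp1 : ∀ s a b, ∑ s', p s a b s' = 1)
    (v w : S → ℝ) (s : S) : Lop γ r p v s ≤ Lop γ r p w s + γ * dist v w := by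
  refine iSup_iInf_expectedPayoff_le_add
    (q := fun a b => r s a b + γ * ∑ s', p s a b s' * v s')
    (q' := fun a b => r s a b + γ * ∑ s', p s a b s' * w s') fun a b => ?_
  have hvw : ∑ s', p s a b s' * v s' ≤ ∑ s', p s a b s' * w s' + dist v w :=
    sum_stdSimplex_mul_le ⟨p s a b, hp0 s a b, hp1 s a b⟩ fun s' => by
      have := (le_abs_self (v s' - w s')).trans (dist_le_pi_dist v w s')
      linarith
  have := mul_le_mul_of_nonneg_left hvw hγ0
  linarith

/-- (Theorem 4.4-(2).)  There exists a unique `v* : S → ℝ` satisfying the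
Bellman optimality equation `L v* = v*`. -/
theorem optimal_value_exists_unique
    {S A B : Type*} [Fintype S] [DecidableEq S] [Nonempty S]
    [Fintype A] [Nonempty A] [Fintype B] [Nonempty B]
    (γ : ℝ) (hγ0 : 0 ≤ γ) (hγ1 : γ < 1)
    (r : S → A → B → ℝ) (p : S → A → B → S → ℝ)
    (hp0 : ∀ s a b s', 0 ≤ p s a b s')
    (hp1 : ∀ s a b, ∑ s', p s a b s' = 1) :
    ∃! v : S → ℝ, Lop γ r p v = v := by
  have hL : ContractingWith ⟨γ, hγ0⟩ (Lop γ r p) :=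
    ⟨hγ1, lipschitzWith_of_apply_le_add (Lop_le_add hγ0 r hp0 hp1)⟩
  exact ⟨ContractingWith.fixedPoint (Lop γ r p) hL, hL.fixedPoint_isFixedPt,
    fun _ hv => hL.fixedPoint_unique hv⟩
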